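/- In ℤ⟦X⟧, the spherical generating functions U and V of the cubic matrix model satisfy U = 1 + 2X·U·V and U·(1 − 2X·V) = 1, and consequently U satisfies the cubic algebraic equation 8X·U^3 − U^2 + 1 = 0. -/

import Mathlib

open PowerSeries Finset

/-- The Cauchy product of two generating functions, with coefficients summed over the index of the
second factor. -/
theorem coeff_mk_mul_mk_eq_sum_range {R : Type*} [Semiring R] (f g : ℕ → R) (n : ℕ) :
    PowerSeries.coeff n (PowerSeries.mk f * PowerSeries.mk g) =
      ∑ p ∈ Finset.range (n + 1), f (n - p) * g p := by
  simp only [PowerSeries.coeff_mul, PowerSeries.coeff_mk]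
  rw [← Finset.Nat.sum_antidiagonal_swap]
  exact Finset.Nat.sum_antidiagonal_eq_sum_range_succ (fun i j => f j * g i) n

/-- The spherical generating functions `U`, `V` of the cubic matrix model satisfy
`U = 1 + 2X·U·V`, `U·(1 - 2X·V) = 1`, and `8X·U³ - U² + 1 = 0` in `ℤ⟦X⟧`. -/
theorem cubic_spherical_U_equation (u v : ℕ → ℤ)
    (hu0 : u 0 = 1)
    (hu : ∀ k : ℕ, u (k + 1) = 2 * ∑ p ∈ Finset.range (k + 1), u (k - p) * v p)
    (hv : ∀ k : ℕ, v k = 2 * u k + ∑ p ∈ Finset.range k, v (k - 1 - p) * v p) :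
    PowerSeries.mk u = 1 + 2 * PowerSeries.X * PowerSeries.mk u * PowerSeries.mk v ∧
    PowerSeries.mk u * (1 - 2 * PowerSeries.X * PowerSeries.mk v) = 1 ∧
    8 * PowerSeries.X * (PowerSeries.mk u) ^ 3 - (PowerSeries.mk u) ^ 2 + 1 = 0 := by
  have hU : PowerSeries.mk u =
      1 + PowerSeries.X * (2 * (PowerSeries.mk u * PowerSeries.mk v)) := by
    ext (_ | k)
    · simp [hu0]
    · rw [map_add, PowerSeries.coeff_succ_X_mul, two_mul, map_add, ← two_mul,
        coeff_mk_mul_mk_eq_sum_range]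
      simp [hu, PowerSeries.coeff_one]
  have hV : PowerSeries.mk v =
      2 * PowerSeries.mk u + PowerSeries.X * (PowerSeries.mk v * PowerSeries.mk v) := by
    rw [two_mul]
    ext (_ | k)
    · simpa [two_mul] using hv 0
    · rw [map_add, map_add, PowerSeries.coeff_succ_X_mul, coeff_mk_mul_mk_eq_sum_range]
      simp only [PowerSeries.coeff_mk]
      rw [hv (k + 1), two_mul, Nat.add_sub_cancel]
  generalize PowerSeries.mk u = U at *
  generalize PowerSeries.mk v = V at *
  have hinv : U * (1 - 2 * PowerSeries.X * V) = 1 := by linear_combination hU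
  refine ⟨by linear_combination hU, hinv, ?_⟩
  linear_combination -(U * (1 - 2 * PowerSeries.X * V) + 1) * hinv
    - 4 * PowerSeries.X * U ^ 2 * hV
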